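/- Strengthened hashing bound: for any integer d > 1 and any real fidelity 1/2 ≤ f ≤ 1, the p.p.t. distillable entanglement of the isotropic state satisfies D_Γ(I_d(f)) ≥ max(log₂ d + f·log₂ f + (1−f)·log₂((1−f)/(d+1)), 0), with the convention 0·log₂ 0 = 0. -/

import Mathlib

open Matrix Filter
open scoped ComplexOrder

noncomputable section

/-- Partial transpose on the second tensor factor:
`ptrans M ((i,j),(k,l)) = M ((i,l),(k,j))`. -/
def ptrans {ι κ : Type*} (M : Matrix (ι × κ) (ι × κ) ℂ) : Matrix (ι × κ) (ι × κ) ℂ :=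
  fun x y => M (x.1, y.2) (y.1, x.2)

/-- Fidelity of `K`-state p.p.t. distillation:
the supremum of `Tr(Fρ)` over Hermitian `F` with `0 ≤ F ≤ 1` and `-1/K ≤ F^Γ ≤ 1/K`. -/
def FGamma {ι κ : Type*} [Fintype ι] [Fintype κ] [DecidableEq ι] [DecidableEq κ]
    (ρ : Matrix (ι × κ) (ι × κ) ℂ) (K : ℝ) : ℝ :=
  sSup {x : ℝ | ∃ F : Matrix (ι × κ) (ι × κ) ℂ,
    F.PosSemidef ∧ (1 - F).PosSemidef ∧
    (((1 / K : ℝ) : ℂ) • 1 - ptrans F).PosSemidef ∧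
    (ptrans F + ((1 / K : ℝ) : ℂ) • 1).PosSemidef ∧
    x = ((F * ρ).trace).re}

/-- `n`-fold tensor power of a bipartite matrix, regrouped as a bipartite matrix. -/
def tpow {ι κ : Type*} (ρ : Matrix (ι × κ) (ι × κ) ℂ) (n : ℕ) :
    Matrix ((Fin n → ι) × (Fin n → κ)) ((Fin n → ι) × (Fin n → κ)) ℂ :=
  fun x y => ∏ i, ρ (x.1 i, x.2 i) (y.1 i, y.2 i)

/-- p.p.t. distillable entanglement. -/
def DGamma {ι κ : Type*} [Fintype ι] [Fintype κ] [DecidableEq ι] [DecidableEq κ]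
    (ρ : Matrix (ι × κ) (ι × κ) ℂ) : ℝ :=
  sSup {r : ℝ | 0 ≤ r ∧
    Tendsto (fun n : ℕ => FGamma (tpow ρ n) ((⌊(2 : ℝ) ^ (r * (n : ℝ))⌋ : ℤ) : ℝ))
      atTop (nhds 1)}

/-- The maximally entangled state `Φ(d) = (1/d) ∑ |ii⟩⟨jj|`. -/
def maxEnt (d : ℕ) : Matrix (Fin d × Fin d) (Fin d × Fin d) ℂ :=
  fun x y => if x.1 = x.2 ∧ y.1 = y.2 then (1 / (d : ℂ)) else 0

/-- The isotropic state `I_d(f) = f Φ(d) + ((1-f)/(d²-1)) (1 - Φ(d))`. -/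
def iso (d : ℕ) (f : ℝ) : Matrix (Fin d × Fin d) (Fin d × Fin d) ℂ :=
  ((f : ℝ) : ℂ) • maxEnt d + (((1 - f) / ((d : ℝ) ^ 2 - 1) : ℝ) : ℂ) • (1 - maxEnt d)

lemma Fin.prod_add_eq_sum_ite {n : ℕ} (f g : Fin n → ℂ) :
    ∏ i, (f i + g i) = ∑ S : Finset (Fin n), ∏ i, if i ∈ S then f i else g i := by
  rw [Finset.prod_add, Finset.powerset_univ]
  refine Finset.sum_congr rfl fun S _ => ?_
  rw [Finset.prod_ite]
  congr 1
  · exact Finset.prod_congr (by ext; simp) fun _ _ => rfl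
  · exact Finset.prod_congr (by ext; simp) fun _ _ => rfl

section TensorFamily

variable {ι κ : Type*} {n : ℕ}

/-- Tensor product of a finite family of bipartite matrices, regrouped as a bipartite matrix. -/
def tensorFamily (M : Fin n → Matrix (ι × κ) (ι × κ) ℂ) :
    Matrix ((Fin n → ι) × (Fin n → κ)) ((Fin n → ι) × (Fin n → κ)) ℂ :=
  fun x y => ∏ i, M i (x.1 i, x.2 i) (y.1 i, y.2 i)

lemma tpow_eq_tensorFamily (ρ : Matrix (ι × κ) (ι × κ) ℂ) :
    tpow ρ n = tensorFamily fun _ => ρ := rfl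

lemma ptrans_tensorFamily (M : Fin n → Matrix (ι × κ) (ι × κ) ℂ) :
    ptrans (tensorFamily M) = tensorFamily fun i => ptrans (M i) := rfl

lemma conjTranspose_tensorFamily (M : Fin n → Matrix (ι × κ) (ι × κ) ℂ) :
    (tensorFamily M)ᴴ = tensorFamily fun i => (M i)ᴴ := by
  ext x y
  simp [tensorFamily, Matrix.conjTranspose_apply]

lemma tensorFamily_smul (c : Fin n → ℂ) (M : Fin n → Matrix (ι × κ) (ι × κ) ℂ) :
    (tensorFamily fun i => c i • M i) = (∏ i, c i) • tensorFamily M := by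
  ext x y
  simp [tensorFamily, Finset.prod_mul_distrib]

lemma tensorFamily_one [DecidableEq ι] [DecidableEq κ] :
    (tensorFamily fun _ : Fin n => (1 : Matrix (ι × κ) (ι × κ) ℂ)) = 1 := by
  ext x y
  by_cases h : x = y
  · subst h
    simp [tensorFamily]
  · rw [Matrix.one_apply_ne h]
    obtain ⟨i, hi⟩ : ∃ i, (x.1 i, x.2 i) ≠ (y.1 i, y.2 i) := by
      by_contra! hc
      exact h (Prod.ext (funext fun i => congrArg Prod.fst (hc i))
        (funext fun i => congrArg Prod.snd (hc i)))
    exact Finset.prod_eq_zero (Finset.mem_univ i) (Matrix.one_apply_ne hi)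

lemma tensorFamily_add (A B : Fin n → Matrix (ι × κ) (ι × κ) ℂ) :
    (tensorFamily fun i => A i + B i) =
      ∑ S : Finset (Fin n), tensorFamily fun i => if i ∈ S then A i else B i := by
  ext x y
  simp only [tensorFamily, Matrix.add_apply, Matrix.sum_apply, Fin.prod_add_eq_sum_ite]
  refine Finset.sum_congr rfl fun S _ => Finset.prod_congr rfl fun i _ => ?_
  split_ifs <;> rfl

lemma sum_regroup [Fintype ι] [Fintype κ] (g : Fin n → ι × κ → ℂ) :
    ∑ x : (Fin n → ι) × (Fin n → κ), ∏ i, g i (x.1 i, x.2 i) = ∏ i, ∑ z, g i z := by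
  classical
  rw [Finset.prod_univ_sum, Fintype.piFinset_univ,
    ← (Equiv.arrowProdEquivProdArrow (Fin n) (fun _ => ι) fun _ => κ).sum_comp]
  rfl

lemma tensorFamily_mul [Fintype ι] [Fintype κ] (A B : Fin n → Matrix (ι × κ) (ι × κ) ℂ) :
    tensorFamily A * tensorFamily B = tensorFamily fun i => A i * B i := by
  ext x y
  simp only [tensorFamily, Matrix.mul_apply, ← Finset.prod_mul_distrib]
  exact sum_regroup fun i z => A i (x.1 i, x.2 i) z * B i z (y.1 i, y.2 i)

lemma trace_tensorFamily [Fintype ι] [Fintype κ] (A : Fin n → Matrix (ι × κ) (ι × κ) ℂ) :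
    (tensorFamily A).trace = ∏ i, (A i).trace :=
  sum_regroup fun i z => A i z z

open scoped MatrixOrder in
lemma Matrix.PosSemidef.exists_eq_conjTranspose_mul_self {m : Type*} [Fintype m]
    {A : Matrix m m ℂ} (hA : A.PosSemidef) : ∃ B : Matrix m m ℂ, A = Bᴴ * B := by
  classical
  exact CStarAlgebra.nonneg_iff_eq_star_mul_self.mp hA.nonneg

lemma posSemidef_tensorFamily [Fintype ι] [Fintype κ] {A : Fin n → Matrix (ι × κ) (ι × κ) ℂ}
    (hA : ∀ i, (A i).PosSemidef) : (tensorFamily A).PosSemidef := by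
  choose B hB using fun i => (hA i).exists_eq_conjTranspose_mul_self
  rw [show A = fun i => (B i)ᴴ * B i from funext hB, ← tensorFamily_mul,
    ← conjTranspose_tensorFamily]
  exact Matrix.posSemidef_conjTranspose_mul_self _

/-- Two-sided operator bounds are multiplicative under tensor products. -/
lemma posSemidef_prod_smul_one_sub_and_add [Fintype ι] [Fintype κ] [DecidableEq ι] [DecidableEq κ]
    {A : Fin n → Matrix (ι × κ) (ι × κ) ℂ} {c : Fin n → ℝ}
    (h₁ : ∀ i, ((c i : ℂ) • 1 - A i).PosSemidef) (h₂ : ∀ i, (A i + (c i : ℂ) • 1).PosSemidef) :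
    (((∏ i, c i : ℝ) : ℂ) • 1 - tensorFamily A).PosSemidef ∧
      (tensorFamily A + ((∏ i, c i : ℝ) : ℂ) • 1).PosSemidef := by
  set X : Fin n → Matrix (ι × κ) (ι × κ) ℂ := fun i => ((1 / 2 : ℝ) : ℂ) • ((c i : ℂ) • 1 - A i)
    with hX
  set Y : Fin n → Matrix (ι × κ) (ι × κ) ℂ := fun i => ((1 / 2 : ℝ) : ℂ) • (A i + (c i : ℂ) • 1)
    with hY
  have half : (0 : ℂ) ≤ ((1 / 2 : ℝ) : ℂ) := by exact_mod_cast (by norm_num : (0 : ℝ) ≤ 1 / 2)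
  have hXp : ∀ i, (X i).PosSemidef := fun i => (h₁ i).smul half
  have hYp : ∀ i, (Y i).PosSemidef := fun i => (h₂ i).smul half
  let Z : Finset (Fin n) → Matrix ((Fin n → ι) × (Fin n → κ)) ((Fin n → ι) × (Fin n → κ)) ℂ :=
    fun S => tensorFamily fun i => if i ∈ S then X i else Y i
  have hZ : ∀ S, (Z S).PosSemidef := fun S => posSemidef_tensorFamily fun i => by
    split_ifs
    exacts [hXp i, hYp i]
  have hc : (((∏ i, c i : ℝ) : ℂ) • 1 : Matrix ((Fin n → ι) × (Fin n → κ)) _ ℂ) = ∑ S, Z S := by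
    rw [← tensorFamily_add, ← tensorFamily_one, Complex.ofReal_prod, ← tensorFamily_smul]
    congr 1
    funext i
    rw [hX, hY]
    module
  have hA : tensorFamily A = ∑ S : Finset (Fin n), ((-1 : ℝ) ^ S.card : ℝ) • Z S := by
    have hAi : A = fun i => -X i + Y i := by
      funext i
      rw [hX, hY]
      module
    rw [hAi, tensorFamily_add]
    refine Finset.sum_congr rfl fun S _ => ?_
    have : (fun i => if i ∈ S then -X i else Y i) =
        fun i => (if i ∈ S then (-1 : ℂ) else 1) • (if i ∈ S then X i else Y i) := by
      funext i
      split_ifs <;> simp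
    rw [this, tensorFamily_smul, Finset.prod_ite_mem_eq, Finset.prod_const]
    ext x y
    simp [Z]
  have hs : ∀ S : Finset (Fin n), (-1 : ℝ) ≤ (-1) ^ S.card ∧ ((-1 : ℝ)) ^ S.card ≤ 1 := fun S => by
    rcases neg_one_pow_eq_or ℝ S.card with h | h <;> rw [h] <;> norm_num
  rw [hc, hA, ← Finset.sum_sub_distrib, ← Finset.sum_add_distrib]
  constructor
  · refine Matrix.posSemidef_sum _ fun S _ => ?_
    rw [show Z S - ((-1 : ℝ) ^ S.card) • Z S = (1 - (-1 : ℝ) ^ S.card) • Z S by module]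
    exact (hZ S).smul (by linarith [(hs S).2])
  · refine Matrix.posSemidef_sum _ fun S _ => ?_
    rw [show ((-1 : ℝ) ^ S.card) • Z S + Z S = ((-1 : ℝ) ^ S.card + 1) • Z S by module]
    exact (hZ S).smul (by linarith [(hs S).1])

lemma sum_norm_tpow_le [Fintype ι] [Fintype κ] (ρ : Matrix (ι × κ) (ι × κ) ℂ) :
    ∃ C : ℝ, 0 < C ∧ ∀ n : ℕ, ∑ x, ∑ y, ‖tpow ρ n x y‖ ≤ C ^ n := by
  refine ⟨(Fintype.card (ι × κ) : ℝ) ^ 2 * (∑ x, ∑ y, ‖ρ x y‖) + 1, by positivity, fun n => ?_⟩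
  set B := ∑ x, ∑ y, ‖ρ x y‖ with hB
  have hρ : ∀ x y, ‖ρ x y‖ ≤ B := fun x y =>
    (Finset.single_le_sum (f := fun y => ‖ρ x y‖) (fun _ _ => norm_nonneg _)
      (Finset.mem_univ y)).trans
    (Finset.single_le_sum (f := fun x => ∑ y, ‖ρ x y‖)
      (fun _ _ => Finset.sum_nonneg fun _ _ => norm_nonneg _) (Finset.mem_univ x))
  have hB0 : 0 ≤ B := by positivity
  have hentry : ∀ x y, ‖tpow ρ n x y‖ ≤ B ^ n := fun x y => by
    rw [tpow, norm_prod]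
    exact (Finset.prod_le_prod (fun _ _ => norm_nonneg _) fun i _ => hρ _ _).trans (by simp)
  calc ∑ x, ∑ y, ‖tpow ρ n x y‖
      ≤ ∑ _x : (Fin n → ι) × (Fin n → κ), ∑ _y : (Fin n → ι) × (Fin n → κ), B ^ n :=
        Finset.sum_le_sum fun x _ => Finset.sum_le_sum fun y _ => hentry x y
    _ = ((Fintype.card (ι × κ) : ℝ) ^ 2 * B) ^ n := by
        simp
        ring
    _ ≤ _ := by
        gcongr
        linarith

end TensorFamily

section Fidelity

variable {ι κ : Type*} [Fintype ι] [Fintype κ] [DecidableEq ι] [DecidableEq κ]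

lemma Matrix.PosSemidef.re_trace_mul_nonneg {m : Type*} [Fintype m] {A B : Matrix m m ℂ}
    (hA : A.PosSemidef) (hB : B.PosSemidef) : 0 ≤ (A * B).trace.re := by
  obtain ⟨C, rfl⟩ := hB.exists_eq_conjTranspose_mul_self
  rw [← Matrix.mul_assoc, Matrix.trace_mul_comm, ← Matrix.mul_assoc]
  exact (Complex.le_def.mp (hA.mul_mul_conjTranspose_same C).trace_nonneg).1

lemma re_trace_mul_le {ρ F : Matrix (ι × κ) (ι × κ) ℂ} (hρ : ρ.PosSemidef)
    (hF : (1 - F).PosSemidef) : (F * ρ).trace.re ≤ ρ.trace.re := by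
  have := hF.re_trace_mul_nonneg hρ
  rw [Matrix.sub_mul, Matrix.one_mul, Matrix.trace_sub, Complex.sub_re] at this
  linarith

lemma FGamma_le_trace {ρ : Matrix (ι × κ) (ι × κ) ℂ} (hρ : ρ.PosSemidef) (K : ℝ) :
    FGamma ρ K ≤ ρ.trace.re := by
  refine Real.sSup_le ?_ (Complex.le_def.mp hρ.trace_nonneg).1
  rintro x ⟨F, -, hF, -, -, rfl⟩
  exact re_trace_mul_le hρ hF

lemma le_FGamma {ρ F : Matrix (ι × κ) (ι × κ) ℂ} {K : ℝ} (hρ : ρ.PosSemidef)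
    (h₀ : F.PosSemidef) (h₁ : (1 - F).PosSemidef)
    (h₂ : (((1 / K : ℝ) : ℂ) • 1 - ptrans F).PosSemidef)
    (h₃ : (ptrans F + ((1 / K : ℝ) : ℂ) • 1).PosSemidef) :
    (F * ρ).trace.re ≤ FGamma ρ K := by
  refine le_csSup ⟨ρ.trace.re, ?_⟩ ⟨F, h₀, h₁, h₂, h₃, rfl⟩
  rintro x ⟨F, -, hF, -, -, rfl⟩
  exact re_trace_mul_le hρ hF

lemma Matrix.PosSemidef.two_mul_norm_apply_le {m : Type*} [Fintype m] [DecidableEq m]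
    {A : Matrix m m ℂ} (hA : A.PosSemidef) (i j : m) :
    2 * ‖A i j‖ ≤ (A i i).re + (A j j).re := by
  obtain ⟨B, rfl⟩ := hA.exists_eq_conjTranspose_mul_self
  simp only [Matrix.mul_apply, Matrix.conjTranspose_apply, Complex.re_sum, ← Finset.sum_add_distrib]
  calc 2 * ‖∑ k, star (B k i) * B k j‖ ≤ 2 * ∑ k, ‖B k i‖ * ‖B k j‖ := by
        gcongr
        refine (norm_sum_le _ _).trans (le_of_eq ?_)
        simp
    _ = ∑ k, 2 * (‖B k i‖ * ‖B k j‖) := by rw [Finset.mul_sum]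
    _ ≤ _ := by
        refine Finset.sum_le_sum fun k _ => ?_
        have h : ∀ z : ℂ, (star z * z).re = ‖z‖ ^ 2 := fun z => by
          rw [Complex.star_def, ← Complex.normSq_eq_conj_mul_self, Complex.ofReal_re,
            Complex.normSq_eq_norm_sq]
        rw [h, h]
        nlinarith [sq_nonneg (‖B k i‖ - ‖B k j‖)]

lemma norm_apply_le_of_posSemidef {m : Type*} [Fintype m] [DecidableEq m] {M : Matrix m m ℂ}
    {c : ℝ} (h₁ : ((c : ℂ) • 1 - M).PosSemidef) (h₂ : (M + (c : ℂ) • 1).PosSemidef) (i j : m) :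
    ‖M i j‖ ≤ c := by
  have a := h₁.two_mul_norm_apply_le i j
  have b := h₂.two_mul_norm_apply_le i j
  have e : M i j = (1 / 2 : ℂ) * ((M + (c : ℂ) • 1) i j - ((c : ℂ) • 1 - M) i j) := by
    simp only [Matrix.add_apply, Matrix.sub_apply]
    ring
  have d : ∀ k, (((c : ℂ) • 1 - M) k k).re + ((M + (c : ℂ) • 1) k k).re = 2 * c := fun k => by
    simp
    ring
  have h : ‖M i j‖ ≤ 1 / 2 * (‖(M + (c : ℂ) • 1) i j‖ + ‖((c : ℂ) • 1 - M) i j‖) := by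
    rw [e, norm_mul]
    gcongr
    · simp
    · exact norm_sub_le _ _
  linarith [d i, d j]

lemma FGamma_le_sum_norm (ρ : Matrix (ι × κ) (ι × κ) ℂ) {K : ℝ} (hK : 0 < K) :
    FGamma ρ K ≤ 1 / K * ∑ x, ∑ y, ‖ρ x y‖ := by
  refine Real.sSup_le ?_ (by positivity)
  rintro t ⟨F, -, -, h₁, h₂, rfl⟩
  have hF : ∀ x y, ‖F x y‖ ≤ 1 / K := fun x y =>
    norm_apply_le_of_posSemidef h₁ h₂ (x.1, y.2) (y.1, x.2)
  rw [Matrix.trace_mul_comm]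
  refine (Complex.re_le_norm _).trans ?_
  simp only [Matrix.trace, Matrix.diag_apply, Matrix.mul_apply, Finset.mul_sum]
  refine (norm_sum_le _ _).trans (Finset.sum_le_sum fun x _ => (norm_sum_le _ _).trans
    (Finset.sum_le_sum fun y _ => ?_))
  rw [norm_mul, mul_comm]
  gcongr
  exact hF y x

lemma half_le_floor {x : ℝ} (hx : 1 ≤ x) : x / 2 ≤ ((⌊x⌋ : ℤ) : ℝ) := by
  have h1 : (1 : ℝ) ≤ ((⌊x⌋ : ℤ) : ℝ) := by exact_mod_cast Int.le_floor.mpr (by simpa using hx)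
  linarith [Int.lt_floor_add_one x]

lemma bddAbove_rates (ρ : Matrix (ι × κ) (ι × κ) ℂ) :
    BddAbove {r : ℝ | 0 ≤ r ∧
      Tendsto (fun n : ℕ => FGamma (tpow ρ n) ((⌊(2 : ℝ) ^ (r * (n : ℝ))⌋ : ℤ) : ℝ))
        atTop (nhds 1)} := by
  obtain ⟨C, hC, hsum⟩ := sum_norm_tpow_le ρ
  refine ⟨Real.logb 2 C, fun r ⟨hr, hlim⟩ => ?_⟩
  by_contra! hlt
  have hq : C < (2 : ℝ) ^ r := (Real.logb_lt_iff_lt_rpow (by norm_num) hC).mp hlt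
  have h2 : (0 : ℝ) < 2 ^ r := by positivity
  have hbound : ∀ n : ℕ, FGamma (tpow ρ n) ((⌊(2 : ℝ) ^ (r * (n : ℝ))⌋ : ℤ) : ℝ) ≤
      2 * (C / 2 ^ r) ^ n := fun n => by
    have hK := half_le_floor (Real.one_le_rpow (by norm_num : (1 : ℝ) ≤ 2)
      (by positivity : 0 ≤ r * (n : ℝ)))
    rw [Real.rpow_mul (by norm_num), Real.rpow_natCast] at hK ⊢
    have hpos : 0 < ((2 : ℝ) ^ r) ^ n / 2 := by positivity
    calc _ ≤ _ := FGamma_le_sum_norm _ (hpos.trans_le hK)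
      _ ≤ 1 / (((2 : ℝ) ^ r) ^ n / 2) * C ^ n := by
          gcongr
          exact hsum n
      _ = _ := by
          rw [div_pow]
          field_simp
  have h0 : Tendsto (fun n : ℕ => 2 * (C / 2 ^ r) ^ n) atTop (nhds (2 * 0)) :=
    (tendsto_pow_atTop_nhds_zero_of_lt_one (by positivity)
      ((div_lt_one h2).mpr hq)).const_mul 2
  have := le_of_tendsto_of_tendsto' hlim h0 hbound
  norm_num at this

end Fidelity

section Isotropic

/-- The swap operator on `ℂ^d ⊗ ℂ^d`. -/
def swapMatrix (d : ℕ) : Matrix (Fin d × Fin d) (Fin d × Fin d) ℂ :=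
  fun x y => if x.1 = y.2 ∧ y.1 = x.2 then 1 else 0

lemma ptrans_maxEnt (d : ℕ) : ptrans (maxEnt d) = ((1 / d : ℝ) : ℂ) • swapMatrix d := by
  ext x y
  simp [ptrans, maxEnt, swapMatrix]

lemma conjTranspose_swapMatrix (d : ℕ) : (swapMatrix d)ᴴ = swapMatrix d := by
  ext x y
  simp only [Matrix.conjTranspose_apply, swapMatrix]
  split_ifs <;> simp_all

lemma swapMatrix_mul_self (d : ℕ) : swapMatrix d * swapMatrix d = 1 := by
  ext ⟨a, b⟩ ⟨a', b'⟩
  rw [Matrix.mul_apply, Finset.sum_eq_single (b, a)]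
  · simp [swapMatrix, Matrix.one_apply, eq_comm, and_comm]
  · rintro ⟨p, q⟩ - h
    simp only [swapMatrix, ite_mul, one_mul, zero_mul, ite_eq_right_iff]
    rintro ⟨rfl, rfl⟩
    exact absurd rfl h
  · simp

lemma posSemidef_of_mul_self_eq_two_smul {m : Type*} [Fintype m] {A : Matrix m m ℂ}
    (hA : Aᴴ = A) (h : A * A = (2 : ℝ) • A) : A.PosSemidef := by
  have : A = (1 / 2 : ℝ) • (Aᴴ * A) := by
    rw [hA, h, smul_smul]
    norm_num
  rw [this]
  exact (Matrix.posSemidef_conjTranspose_mul_self A).smul (by norm_num)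

lemma posSemidef_one_add_swapMatrix (d : ℕ) : (1 + swapMatrix d).PosSemidef := by
  refine posSemidef_of_mul_self_eq_two_smul ?_ ?_
  · rw [Matrix.conjTranspose_add, conjTranspose_swapMatrix, Matrix.conjTranspose_one]
  · rw [add_mul, mul_add, mul_add, swapMatrix_mul_self, mul_one, mul_one, one_mul]
    module

lemma posSemidef_one_sub_swapMatrix (d : ℕ) : (1 - swapMatrix d).PosSemidef := by
  refine posSemidef_of_mul_self_eq_two_smul ?_ ?_
  · rw [Matrix.conjTranspose_sub, conjTranspose_swapMatrix, Matrix.conjTranspose_one]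
  · rw [sub_mul, mul_sub, mul_sub, swapMatrix_mul_self, mul_one, mul_one, one_mul]
    module

lemma conjTranspose_maxEnt (d : ℕ) : (maxEnt d)ᴴ = maxEnt d := by
  ext x y
  simp only [Matrix.conjTranspose_apply, maxEnt]
  split_ifs <;> simp_all

lemma trace_maxEnt {d : ℕ} (hd : 0 < d) : (maxEnt d).trace = 1 := by
  have : (d : ℂ) ≠ 0 := by exact_mod_cast hd.ne'
  simp [Matrix.trace, maxEnt, Fintype.sum_prod_type, this]

lemma maxEnt_mul_self {d : ℕ} (hd : 0 < d) : maxEnt d * maxEnt d = maxEnt d := by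
  have : (d : ℂ) ≠ 0 := by exact_mod_cast hd.ne'
  ext x y
  rw [Matrix.mul_apply]
  by_cases hx : x.1 = x.2 <;> by_cases hy : y.1 = y.2 <;>
    simp [maxEnt, Fintype.sum_prod_type, hx, hy, this]

lemma posSemidef_maxEnt {d : ℕ} (hd : 0 < d) : (maxEnt d).PosSemidef := by
  rw [← maxEnt_mul_self hd]
  nth_rw 1 [← conjTranspose_maxEnt]
  exact Matrix.posSemidef_conjTranspose_mul_self _

lemma one_sub_maxEnt_mul_self {d : ℕ} (hd : 0 < d) :
    (1 - maxEnt d) * (1 - maxEnt d) = 1 - maxEnt d := by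
  rw [sub_mul, mul_sub, mul_sub, maxEnt_mul_self hd]
  simp

lemma posSemidef_one_sub_maxEnt {d : ℕ} (hd : 0 < d) : (1 - maxEnt d).PosSemidef := by
  rw [← one_sub_maxEnt_mul_self hd]
  have : (1 - maxEnt d)ᴴ = 1 - maxEnt d := by
    rw [Matrix.conjTranspose_sub, conjTranspose_maxEnt, Matrix.conjTranspose_one]
  nth_rw 1 [← this]
  exact Matrix.posSemidef_conjTranspose_mul_self _

lemma posSemidef_iso {d : ℕ} (hd : 1 < d) {f : ℝ} (hf₀ : 0 ≤ f) (hf₁ : f ≤ 1) :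
    (iso d f).PosSemidef := by
  have hd' : (1 : ℝ) < d := by exact_mod_cast hd
  have : 0 ≤ (1 - f) / ((d : ℝ) ^ 2 - 1) := div_nonneg (by linarith) (by nlinarith)
  exact ((posSemidef_maxEnt (by omega)).smul (by exact_mod_cast hf₀)).add
    ((posSemidef_one_sub_maxEnt (by omega)).smul (by exact_mod_cast this))

lemma maxEnt_mul_iso {d : ℕ} (hd : 0 < d) (f : ℝ) :
    maxEnt d * iso d f = (f : ℂ) • maxEnt d := by
  rw [iso, mul_add, mul_smul_comm, mul_smul_comm, mul_sub, maxEnt_mul_self hd]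
  simp

lemma trace_iso {d : ℕ} (hd : 1 < d) (f : ℝ) : (iso d f).trace = 1 := by
  have hd' : (1 : ℝ) < d := by exact_mod_cast hd
  have h : (d : ℝ) ^ 2 - 1 ≠ 0 := by nlinarith
  have h' : (d : ℂ) ^ 2 - 1 ≠ 0 := by exact_mod_cast h
  rw [iso, Matrix.trace_add, Matrix.trace_smul, Matrix.trace_smul, Matrix.trace_sub,
    trace_maxEnt (by omega), Matrix.trace_one]
  simp
  rw [← sq]
  field_simp
  ring

/-- The projector with error pattern `S`: `1 - Φ` at positions in `S`, and `Φ` elsewhere. -/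
def errorProj (d : ℕ) {n : ℕ} (S : Finset (Fin n)) :
    Matrix ((Fin n → Fin d) × (Fin n → Fin d)) ((Fin n → Fin d) × (Fin n → Fin d)) ℂ :=
  tensorFamily fun i => if i ∈ S then 1 - maxEnt d else maxEnt d

variable {d n : ℕ}

lemma posSemidef_errorProj (hd : 0 < d) (S : Finset (Fin n)) : (errorProj d S).PosSemidef :=
  posSemidef_tensorFamily fun i => by
    split_ifs
    exacts [posSemidef_one_sub_maxEnt hd, posSemidef_maxEnt hd]

lemma sum_errorProj (d n : ℕ) : ∑ S : Finset (Fin n), errorProj d S = 1 := by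
  rw [← tensorFamily_one]
  simp only [errorProj]
  rw [← tensorFamily_add]
  simp

lemma prod_ite_mem_const (S : Finset (Fin n)) {R : Type*} [CommMonoid R] (a b : R) :
    (∏ i, if i ∈ S then a else b) = a ^ S.card * b ^ (n - S.card) := by
  rw [Finset.prod_ite, Finset.prod_const, Finset.prod_const]
  congr 2
  · simp
  · rw [Finset.filter_not, Finset.card_sdiff]
    simp

lemma trace_errorProj_mul_tpow_iso (hd : 1 < d) (f : ℝ) (S : Finset (Fin n)) :
    (errorProj d S * tpow (iso d f) n).trace.re = (1 - f) ^ S.card * f ^ (n - S.card) := by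
  rw [errorProj, tpow_eq_tensorFamily, tensorFamily_mul, trace_tensorFamily]
  have h : ∀ i, ((if i ∈ S then 1 - maxEnt d else maxEnt d) * iso d f).trace =
      if i ∈ S then ((1 - f : ℝ) : ℂ) else (f : ℂ) := fun i => by
    split_ifs
    · rw [sub_mul, one_mul, Matrix.trace_sub, maxEnt_mul_iso (by omega), Matrix.trace_smul,
        trace_maxEnt (by omega), trace_iso hd]
      simp
    · rw [maxEnt_mul_iso (by omega), Matrix.trace_smul, trace_maxEnt (by omega)]
      simp
  rw [Finset.prod_congr rfl fun i _ => h i, prod_ite_mem_const]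
  exact_mod_cast Complex.ofReal_re _

lemma ptrans_one_sub {ι κ : Type*} [DecidableEq ι] [DecidableEq κ]
    (M : Matrix (ι × κ) (ι × κ) ℂ) : ptrans (1 - M) = 1 - ptrans M := by
  ext x y
  simp only [ptrans, Matrix.sub_apply, Matrix.one_apply, Prod.ext_iff]
  congr 2
  rw [eq_comm (a := x.2)]

lemma ptrans_sum {α ι κ : Type*} (T : Finset α) (M : α → Matrix (ι × κ) (ι × κ) ℂ) :
    ptrans (∑ S ∈ T, M S) = ∑ S ∈ T, ptrans (M S) := by
  ext x y
  simp [ptrans, Matrix.sum_apply]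

lemma ptrans_errorProj_bounds (hd : 0 < d) (S : Finset (Fin n)) :
    (((((d + 1 : ℝ) / d) ^ S.card * (1 / d) ^ (n - S.card) : ℝ) : ℂ) • 1 -
        ptrans (errorProj d S)).PosSemidef ∧
      (ptrans (errorProj d S) +
        ((((d + 1 : ℝ) / d) ^ S.card * (1 / d) ^ (n - S.card) : ℝ) : ℂ) • 1).PosSemidef := by
  have hd' : (d : ℂ) ≠ 0 := by exact_mod_cast hd.ne'
  have hinv : (0 : ℝ) ≤ 1 / d := by positivity
  have hadd := (posSemidef_one_add_swapMatrix d).smul hinv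
  have hsub := (posSemidef_one_sub_swapMatrix d).smul hinv
  have htwo : ((2 : ℝ) • (1 : Matrix (Fin d × Fin d) (Fin d × Fin d) ℂ)).PosSemidef :=
    Matrix.PosSemidef.one.smul (by norm_num)
  have hc : ((((d + 1 : ℝ) / d : ℝ)) : ℂ) = 1 + ((1 / d : ℝ) : ℂ) := by
    push_cast
    field_simp
  rw [← prod_ite_mem_const, errorProj, ptrans_tensorFamily]
  apply posSemidef_prod_smul_one_sub_and_add
  · intro i
    split_ifs
    · rw [ptrans_one_sub, ptrans_maxEnt, hc]
      convert hadd using 1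
      ext x y
      simp
      ring
    · rw [ptrans_maxEnt]
      convert hsub using 1
      ext x y
      simp
      ring
  · intro i
    split_ifs
    · rw [ptrans_one_sub, ptrans_maxEnt, hc]
      convert hsub.add htwo using 1
      ext x y
      simp
      ring
    · rw [ptrans_maxEnt]
      convert hadd using 1
      ext x y
      simp
      ring

lemma posSemidef_smul_one_mono {m : Type*} [DecidableEq m] {a b : ℝ} (h : a ≤ b) :
    ((b : ℂ) • (1 : Matrix m m ℂ) - (a : ℂ) • 1).PosSemidef := by
  rw [← sub_smul]
  exact Matrix.PosSemidef.one.smul (by exact_mod_cast sub_nonneg.mpr h)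

/-- Accepting a set `T` of error patterns whose partial transposes have total norm at most `1 / K`
achieves as fidelity the probability of `T`. -/
lemma sum_prob_le_FGamma (hd : 1 < d) {f : ℝ} (hf₀ : 0 ≤ f) (hf₁ : f ≤ 1) {K : ℝ}
    (T : Finset (Finset (Fin n)))
    (hT : ∑ S ∈ T, ((d + 1 : ℝ) / d) ^ S.card * (1 / d) ^ (n - S.card) ≤ 1 / K) :
    ∑ S ∈ T, (1 - f) ^ S.card * f ^ (n - S.card) ≤ FGamma (tpow (iso d f) n) K := by
  have hd0 : 0 < d := by omega
  have hp := fun S => ptrans_errorProj_bounds hd0 (n := n) S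
  set c : Finset (Fin n) → ℝ := fun S => ((d + 1 : ℝ) / d) ^ S.card * (1 / d) ^ (n - S.card)
  have hmono := posSemidef_smul_one_mono (m := (Fin n → Fin d) × (Fin n → Fin d)) hT
  have hsum : (((∑ S ∈ T, c S : ℝ) : ℂ) • 1 :
      Matrix ((Fin n → Fin d) × (Fin n → Fin d)) ((Fin n → Fin d) × (Fin n → Fin d)) ℂ) =
      ∑ S ∈ T, (c S : ℂ) • 1 := by
    rw [Complex.ofReal_sum, Finset.sum_smul]
  rw [hsum] at hmono
  have key := le_FGamma (ρ := tpow (iso d f) n) (F := ∑ S ∈ T, errorProj d S) (K := K)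
    (posSemidef_tensorFamily fun _ => posSemidef_iso hd hf₀ hf₁)
    (Matrix.posSemidef_sum _ fun S _ => posSemidef_errorProj hd0 S) ?_ ?_ ?_
  · rw [Finset.sum_mul, Matrix.trace_sum, Complex.re_sum] at key
    simpa only [trace_errorProj_mul_tpow_iso hd] using key
  · rw [← sum_errorProj, ← Finset.sum_sdiff (Finset.subset_univ T), add_sub_cancel_right]
    exact Matrix.posSemidef_sum _ fun S _ => posSemidef_errorProj hd0 S
  · rw [ptrans_sum]
    convert hmono.add (Matrix.posSemidef_sum T fun S _ => (hp S).1) using 1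
    rw [Finset.sum_sub_distrib]
    abel
  · rw [ptrans_sum]
    convert hmono.add (Matrix.posSemidef_sum T fun S _ => (hp S).2) using 1
    rw [Finset.sum_add_distrib]
    abel

end Isotropic

section Typicality

variable {n : ℕ}

lemma sum_binomial_variance (n : ℕ) (q : ℝ) :
    ∑ S : Finset (Fin n), q ^ S.card * (1 - q) ^ (n - S.card) * (S.card - n * q) ^ 2 =
      n * q * (1 - q) := by
  have h := congrArg (Polynomial.eval q) (bernsteinPolynomial.variance ℝ n)
  have hs := Finset.sum_powerset_apply_card
    (fun k : ℕ => q ^ k * (1 - q) ^ (n - k) * ((k : ℝ) - n * q) ^ 2)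
    (x := (Finset.univ : Finset (Fin n)))
  rw [Finset.powerset_univ, Finset.card_univ, Fintype.card_fin] at hs
  rw [hs]
  simp only [Polynomial.eval_finsetSum, bernsteinPolynomial, Polynomial.eval_mul,
    Polynomial.eval_pow, Polynomial.eval_sub, Polynomial.eval_X,
    Polynomial.eval_natCast, Polynomial.eval_one, nsmul_eq_mul] at h
  rw [← h]
  refine Finset.sum_congr rfl fun k _ => ?_
  rw [nsmul_eq_mul]
  ring

lemma sum_prob_eq_one (n : ℕ) (q : ℝ) :
    ∑ S : Finset (Fin n), q ^ S.card * (1 - q) ^ (n - S.card) = 1 := by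
  rw [Fin.sum_pow_mul_eq_add_pow]
  simp

/-- Chebyshev's inequality for the number of errors. -/
lemma one_sub_le_sum_prob {q δ : ℝ} (hq₀ : 0 ≤ q) (hq₁ : q ≤ 1) (hδ : 0 < δ) (hn : 0 < n)
    (T : Finset (Finset (Fin n)))
    (hT : ∀ S : Finset (Fin n), |(S.card : ℝ) - n * q| ≤ δ * n → S ∈ T) :
    1 - (q * (1 - q) / δ ^ 2) / n ≤ ∑ S ∈ T, q ^ S.card * (1 - q) ^ (n - S.card) := by
  have hq : 0 ≤ 1 - q := by linarith
  have hn' : (0 : ℝ) < n := by exact_mod_cast hn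
  have hδn : 0 < (δ * n) ^ 2 := by positivity
  have hsplit := Finset.sum_sdiff (Finset.subset_univ T)
    (f := fun S : Finset (Fin n) => q ^ S.card * (1 - q) ^ (n - S.card))
  rw [sum_prob_eq_one] at hsplit
  have htail : (∑ S ∈ Finset.univ \ T, q ^ S.card * (1 - q) ^ (n - S.card)) * (δ * n) ^ 2 ≤
      n * q * (1 - q) := by
    rw [← sum_binomial_variance, Finset.sum_mul]
    refine (Finset.sum_le_sum fun S hS => ?_).trans
      (Finset.sum_le_sum_of_subset_of_nonneg (Finset.subset_univ (Finset.univ \ T))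
        fun S _ _ => by positivity)
    have hlt : δ * n < |(S.card : ℝ) - n * q| := by
      by_contra! hle
      exact (Finset.mem_sdiff.mp hS).2 (hT S hle)
    rw [← sq_abs ((S.card : ℝ) - n * q)]
    gcongr
  rw [← le_div_iff₀ hδn] at htail
  have : n * q * (1 - q) / (δ * n) ^ 2 = (q * (1 - q) / δ ^ 2) / n := by
    field_simp
  linarith

end Typicality

/-- At rates below the hashing rate, patterns with about `n (1 - f)` errors have a probability
exceeding the norm of their partial transposes by a factor `2 ^ (r n)`. -/
lemma exists_typical_weight_le {d : ℕ} (hd : 0 < d) {f r : ℝ} (hf₀ : 0 < f) (hf₁ : f < 1)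
    (hr : r < Real.logb 2 (d : ℝ) + f * Real.logb 2 f +
      (1 - f) * Real.logb 2 ((1 - f) / ((d : ℝ) + 1))) :
    ∃ δ : ℝ, 0 < δ ∧ ∀ n k : ℕ, k ≤ n → |(k : ℝ) - n * (1 - f)| ≤ δ * n →
      ((d + 1 : ℝ) / d) ^ k * (1 / d) ^ (n - k) * 2 ^ (r * (n : ℝ)) ≤
        (1 - f) ^ k * f ^ (n - k) := by
  have hq : 0 < 1 - f := by linarith
  have hd' : (0 : ℝ) < d := by exact_mod_cast hd
  have hd1 : (0 : ℝ) < d + 1 := by positivity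
  rw [Real.logb_div hq.ne' hd1.ne'] at hr
  set L : ℝ := |Real.logb 2 (d + 1) + Real.logb 2 f - Real.logb 2 (1 - f)| + 1 with hL
  have hLpos : 0 < L := by positivity
  set v : ℝ := Real.logb 2 (d : ℝ) + f * Real.logb 2 f +
      (1 - f) * (Real.logb 2 (1 - f) - Real.logb 2 ((d : ℝ) + 1)) with hv
  refine ⟨(v - r) / L, div_pos (by linarith) hLpos, fun n k hk hδ => ?_⟩
  rw [← Real.logb_le_logb (b := 2) (by norm_num) (by positivity) (by positivity),
    Real.logb_mul (by positivity) (by positivity), Real.logb_mul (by positivity) (by positivity),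
    Real.logb_mul (by positivity) (by positivity), Real.logb_rpow (by norm_num) (by norm_num),
    Real.logb_pow, Real.logb_pow, Real.logb_pow, Real.logb_pow,
    Real.logb_div hd1.ne' hd'.ne', one_div, Real.logb_inv, Nat.cast_sub hk]
  have hdev : ((k : ℝ) - n * (1 - f)) *
      (Real.logb 2 (d + 1) + Real.logb 2 f - Real.logb 2 (1 - f)) ≤ n * (v - r) :=
    calc _ ≤ |((k : ℝ) - n * (1 - f))| *
          |Real.logb 2 (d + 1) + Real.logb 2 f - Real.logb 2 (1 - f)| := by
          rw [← abs_mul]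
          exact le_abs_self _
      _ ≤ ((v - r) / L * n) * L := by
          gcongr
          linarith
      _ = n * (v - r) := by
          field_simp
  rw [hv] at hdev
  linarith

lemma one_div_le_one_div_floor {x : ℝ} (hx : 1 ≤ x) : 1 / x ≤ 1 / ((⌊x⌋ : ℤ) : ℝ) := by
  have := half_le_floor hx
  exact one_div_le_one_div_of_le (by linarith) (Int.floor_le x)

/-- Every nonnegative rate below the hashing rate is achievable. -/
lemma tendsto_FGamma_tpow_iso {d : ℕ} (hd : 1 < d) {f r : ℝ} (hf₀ : 0 < f) (hf₁ : f ≤ 1)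
    (hr₀ : 0 ≤ r) (hr : r < Real.logb 2 (d : ℝ) + f * Real.logb 2 f +
      (1 - f) * Real.logb 2 ((1 - f) / ((d : ℝ) + 1))) :
    Tendsto (fun n : ℕ => FGamma (tpow (iso d f) n) ((⌊(2 : ℝ) ^ (r * (n : ℝ))⌋ : ℤ) : ℝ))
      atTop (nhds 1) := by
  have hd0 : (0 : ℝ) < d := by exact_mod_cast (by omega : 0 < d)
  have hfloor : ∀ n : ℕ, 1 / (2 : ℝ) ^ (r * (n : ℝ)) ≤
      1 / ((⌊(2 : ℝ) ^ (r * (n : ℝ))⌋ : ℤ) : ℝ) := fun n =>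
    one_div_le_one_div_floor (Real.one_le_rpow (by norm_num) (by positivity))
  have hupper : ∀ n : ℕ,
      FGamma (tpow (iso d f) n) ((⌊(2 : ℝ) ^ (r * (n : ℝ))⌋ : ℤ) : ℝ) ≤ 1 := fun n => by
    refine (FGamma_le_trace
      (posSemidef_tensorFamily fun _ => posSemidef_iso hd hf₀.le hf₁) _).trans (le_of_eq ?_)
    rw [trace_tensorFamily]
    simp [trace_iso hd]
  suffices hlower : ∃ C : ℝ, ∀ n : ℕ, 0 < n →
      1 - C / n ≤ FGamma (tpow (iso d f) n) ((⌊(2 : ℝ) ^ (r * (n : ℝ))⌋ : ℤ) : ℝ) by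
    obtain ⟨C, hC⟩ := hlower
    have hlim : Tendsto (fun n : ℕ => 1 - C / (n : ℝ)) atTop (nhds (1 - 0)) :=
      (tendsto_const_div_atTop_nhds_zero_nat C).const_sub 1
    rw [sub_zero] at hlim
    exact tendsto_of_tendsto_of_tendsto_of_le_of_le' hlim tendsto_const_nhds
      ((eventually_gt_atTop 0).mono hC) (Eventually.of_forall hupper)
  rcases hf₁.eq_or_lt with rfl | hf
  · refine ⟨0, fun n _ => ?_⟩
    have hpow : (2 : ℝ) ^ (r * (n : ℝ)) ≤ (d : ℝ) ^ n := by
      rw [Real.rpow_mul (by norm_num), Real.rpow_natCast]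
      gcongr
      exact ((Real.lt_logb_iff_rpow_lt (by norm_num) hd0).mp (by simpa using hr)).le
    have key := sum_prob_le_FGamma hd zero_le_one le_rfl
      (K := ((⌊(2 : ℝ) ^ (r * (n : ℝ))⌋ : ℤ) : ℝ)) {(∅ : Finset (Fin n))} (by
        refine le_trans ?_ (hfloor n)
        simp only [Finset.sum_singleton, Finset.card_empty, pow_zero, one_mul, Nat.sub_zero,
          _root_.one_div_pow]
        exact one_div_le_one_div_of_le (by positivity) hpow)
    simpa using key
  · obtain ⟨δ, hδ, htyp⟩ := exists_typical_weight_le (by omega) hf₀ hf hr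
    refine ⟨(1 - f) * f / δ ^ 2, fun n hn => ?_⟩
    have hq : 0 ≤ 1 - f := by linarith
    set T : Finset (Finset (Fin n)) :=
      {S | |(S.card : ℝ) - n * (1 - f)| ≤ δ * n} with hT
    have hprob := one_sub_le_sum_prob hq (by linarith) hδ hn T fun S hS => by simpa [hT] using hS
    have htotal := sum_prob_eq_one n (1 - f)
    rw [sub_sub_cancel] at hprob htotal
    refine hprob.trans (sum_prob_le_FGamma hd hf₀.le hf₁ T (le_trans ?_ (hfloor n)))
    rw [le_div_iff₀ (by positivity), Finset.sum_mul]
    refine le_trans ?_ htotal.le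
    refine (Finset.sum_le_sum fun S hS => htyp n S.card ?_ (by simpa [hT] using hS)).trans
      (Finset.sum_le_sum_of_subset_of_nonneg (Finset.subset_univ T) fun S _ _ => by positivity)
    simpa using Finset.card_le_univ S

/-- Strengthened hashing lower bound for isotropic states. -/
theorem DGamma_isotropic_hashing (d : ℕ) (hd : 1 < d) (f : ℝ)
    (hf₀ : 1 / 2 ≤ f) (hf₁ : f ≤ 1) :
    max (Real.logb 2 (d : ℝ) + f * Real.logb 2 f +
        (1 - f) * Real.logb 2 ((1 - f) / ((d : ℝ) + 1))) 0 ≤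
      DGamma (iso d f) := by
  have hnonneg : 0 ≤ DGamma (iso d f) := Real.sSup_nonneg fun r hr => hr.1
  refine max_le (le_of_forall_lt_imp_le_of_dense fun r hr => ?_) hnonneg
  rcases lt_or_ge r 0 with hr₀ | hr₀
  · exact hr₀.le.trans hnonneg
  · exact le_csSup (bddAbove_rates _)
      ⟨hr₀, tendsto_FGamma_tpow_iso hd (by linarith) hf₁ hr₀ hr⟩
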